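/- arXiv:2310.17309 — 2 statements merged into one kernel-verified Lean document; each statement's English description precedes it below -/
import Mathlib

section
/- Let 1 ≤ p < ∞ and 0 < σ < p. Let P_μ be the orthogonal projection of L^2(Ω) onto S_μ = S(ℱ_μ), and assume there is a constant M such that ‖P_μ : L^p → L^p‖ ≤ M for all μ. Then for every f ∈ L^p(S): |f|_{V_{σ,p}} ≤ liminf_{μ→∞} |P_μ f|_{V_{σ,p}} ≤ limsup_{μ→∞} |P_μ f|_{V_{σ,p}} ≤ sup_{μ} |P_μ f|_{V_{σ,p}} ≤ M·|f|_{V_{σ,p}}, with the same constant M. -/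
open MeasureTheory ENNReal Set Filter
open scoped ENNReal NNReal Classical

noncomputable section

variable {Ω : Type} [MeasurableSpace Ω]

/-- The data of a filtration on `Ω`, recorded through the (finitely many) atoms of each
σ-algebra `ℱ_n`. -/
structure FiltrationAtoms (Ω : Type) [MeasurableSpace Ω] (μ : Measure Ω) where
  atoms : ℕ → Set (Set Ω)
  atoms_finite : ∀ n, (atoms n).Finite
  atoms_measurable : ∀ n, ∀ A ∈ atoms n, MeasurableSet A
  atoms_zero : atoms 0 = {Set.univ}
  atoms_disjoint : ∀ n, (atoms n).Pairwise Disjoint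
  atoms_cover : ∀ n, ⋃₀ atoms n = Set.univ
  atoms_pos : ∀ n, ∀ A ∈ atoms n, 0 < μ A
  atoms_refine : ∀ n, ∀ B ∈ atoms (n + 1), ∃ A ∈ atoms n, B ⊆ A

namespace FiltrationAtoms

variable {μ : Measure Ω}

/-- The collection `𝒜` of all atoms of the filtration. -/
def Atoms (F : FiltrationAtoms Ω μ) : Set (Set Ω) := ⋃ n, F.atoms n

/-- A `ν`-ary filtration: every atom of `ℱ_n` is the union of at most `ν` atoms of `ℱ_{n+1}`. -/
def IsNuAry (F : FiltrationAtoms Ω μ) (ν : ℕ) : Prop :=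
  ∀ n, ∀ A ∈ F.atoms n, ∃ T : Finset (Set Ω),
    T.card ≤ ν ∧ ↑T ⊆ F.atoms (n + 1) ∧ A = ⋃₀ ↑T

/-- A binary filtration: in the passage from `ℱ_n` to `ℱ_{n+1}`, exactly one atom `A` is
subdivided into two atoms `A'`, `A''` of positive measure with `μ A' ≤ μ A''`. -/
def IsBinary (F : FiltrationAtoms Ω μ) : Prop :=
  ∀ n, ∃ A ∈ F.atoms n, ∃ A' A'' : Set Ω, A' ∈ F.atoms (n + 1) ∧ A'' ∈ F.atoms (n + 1) ∧
    Disjoint A' A'' ∧ A = A' ∪ A'' ∧ μ A' ≤ μ A'' ∧ 0 < μ A' ∧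
    F.atoms (n + 1) = insert A' (insert A'' (F.atoms n \ {A}))

/-- `B` is one of the atoms into which the atom `A` is subdivided. -/
def IsChildOf (F : FiltrationAtoms Ω μ) (B A : Set Ω) : Prop :=
  ∃ n, A ∈ F.atoms n ∧ B ∈ F.atoms (n + 1) ∧ B ⊂ A

/-- `R` is an atom or a (nonempty) ring, i.e. a difference `A \ B` of two nested atoms. -/
def IsAtomOrRing (F : FiltrationAtoms Ω μ) (R : Set Ω) : Prop :=
  R ∈ F.Atoms ∨ ∃ A ∈ F.Atoms, ∃ B ∈ F.Atoms, B ⊆ A ∧ R = A \ B ∧ R.Nonempty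

end FiltrationAtoms

/-- The stability condition on the finite-dimensional space `S`:
there are `c₁, c₂ ∈ (0,1]` with `|{ω ∈ A : |f ω| ≥ c₁ ‖f‖_{L^∞(A)}}| ≥ c₂ |A|` for all
`f ∈ S` and all atoms `A`. -/
def StabilityCondition {μ : Measure Ω} (F : FiltrationAtoms Ω μ)
    (S : Submodule ℝ (Ω → ℝ)) : Prop :=
  ∃ c₁ ∈ Set.Ioc (0:ℝ) 1, ∃ c₂ ∈ Set.Ioc (0:ℝ) 1,
    ∀ A ∈ F.Atoms, ∀ f ∈ S,
      ENNReal.ofReal c₂ * μ A ≤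
        μ {ω | ω ∈ A ∧
          ENNReal.ofReal c₁ * eLpNormEssSup f (μ.restrict A) ≤ ENNReal.ofReal |f ω|}

/-- `E_p(f,R)`: the error of best `L^p(R)`-approximation of `f` by elements of `S` (restricted
to `R`). -/
def Ep (S : Submodule ℝ (Ω → ℝ)) (p : ℝ) (μ : Measure Ω) (f : Ω → ℝ) (R : Set Ω) : ℝ≥0∞ :=
  ⨅ g ∈ S, eLpNorm (f - g) (ENNReal.ofReal p) (μ.restrict R)

/-- The ring-variation seminorm `|f|_{V_{σ,p}}`: the supremum of
`(∑_{R ∈ P} E_p(f,R)^σ)^{1/σ}` over all finite collections `P` of pairwise disjoint atoms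
or rings. -/
def varSeminorm {μ : Measure Ω} (F : FiltrationAtoms Ω μ)
    (S : Submodule ℝ (Ω → ℝ)) (σ p : ℝ) (f : Ω → ℝ) : ℝ≥0∞ :=
  ⨆ (P : Finset (Set Ω)) (_ : ∀ R ∈ P, F.IsAtomOrRing R)
    (_ : (↑P : Set (Set Ω)).Pairwise Disjoint),
    (∑ R ∈ P, Ep S p μ f R ^ σ) ^ (1 / σ)

/-- The full variation norm `‖f‖_{V_{σ,p}} = ‖f‖_p + |f|_{V_{σ,p}}`. -/
def varNorm {μ : Measure Ω} (F : FiltrationAtoms Ω μ)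
    (S : Submodule ℝ (Ω → ℝ)) (σ p : ℝ) (f : Ω → ℝ) : ℝ≥0∞ :=
  eLpNorm f (ENNReal.ofReal p) μ + varSeminorm F S σ p f

/-- The dictionary `𝒞 = {g·1_A : g ∈ S, A ∈ 𝒜}`. -/
def dictC {μ : Measure Ω} (F : FiltrationAtoms Ω μ) (S : Submodule ℝ (Ω → ℝ)) :
    Set (Ω → ℝ) :=
  {h | ∃ g ∈ S, ∃ A ∈ F.Atoms, h = A.indicator g}

/-- `Σ_n^D`: linear combinations of at most `n` elements of the dictionary `D`. -/
def SigmaN (D : Set (Ω → ℝ)) (n : ℕ) : Set (Ω → ℝ) :=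
  {h | ∃ c : Fin n → ℝ, ∃ x : Fin n → Ω → ℝ, (∀ j, x j ∈ D) ∧ h = ∑ j, c j • x j}

/-- `σ_n(f, D)`: the error of best `n`-term approximation in `L^p` with respect to the
dictionary `D`. -/
def bestApprox (D : Set (Ω → ℝ)) (p : ℝ) (μ : Measure Ω) (f : Ω → ℝ) (n : ℕ) : ℝ≥0∞ :=
  ⨅ y ∈ SigmaN D n, eLpNorm (f - y) (ENNReal.ofReal p) μ

/-- The `ℓ^q` norm (`0 < q ≤ ∞`) of a sequence of extended nonnegative reals. -/
def lqNorm (q : ℝ≥0∞) (a : ℕ → ℝ≥0∞) : ℝ≥0∞ :=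
  if q = ∞ then ⨆ n, a n else (∑' n, a n ^ q.toReal) ^ (1 / q.toReal)

/-- The quasi-norm of the approximation space `𝒜_q^α`:
`‖f‖_p + ‖(2^{nα} σ_{2^n}(f,D))_n‖_{ℓ^q}`. -/
def approxNorm (D : Set (Ω → ℝ)) (p : ℝ) (q : ℝ≥0∞) (α : ℝ) (μ : Measure Ω)
    (f : Ω → ℝ) : ℝ≥0∞ :=
  eLpNorm f (ENNReal.ofReal p) μ +
    lqNorm q (fun n => (2 : ℝ≥0∞) ^ ((n : ℝ) * α) * bestApprox D p μ f (2 ^ n))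

/-- Membership in `L^p(S)`, the `L^p`-closure of the span of the dictionary `𝒞`. -/
def MemLpS {μ : Measure Ω} (F : FiltrationAtoms Ω μ) (S : Submodule ℝ (Ω → ℝ)) (p : ℝ)
    (f : Ω → ℝ) : Prop :=
  AEMeasurable f μ ∧ eLpNorm f (ENNReal.ofReal p) μ ≠ ∞ ∧
    ∀ ε : ℝ≥0∞, 0 < ε → ∃ n, ∃ y ∈ SigmaN (dictC F S) n,
      eLpNorm (f - y) (ENNReal.ofReal p) μ < ε

/-- Membership in the variation space `V_{σ,p}(S)`. -/
def MemVar {μ : Measure Ω} (F : FiltrationAtoms Ω μ) (S : Submodule ℝ (Ω → ℝ)) (σ p : ℝ)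
    (f : Ω → ℝ) : Prop :=
  MemLpS F S p f ∧ varSeminorm F S σ p f ≠ ∞

/-- The K-functional `K(f, t, L^p, Y)` for a subset `Y` of functions with (quasi-)norm
`yNorm`. -/
def Kfun (p : ℝ) (μ : Measure Ω) (Y : Set (Ω → ℝ)) (yNorm : (Ω → ℝ) → ℝ≥0∞)
    (f : Ω → ℝ) (t : ℝ≥0∞) : ℝ≥0∞ :=
  ⨅ g ∈ Y, eLpNorm (f - g) (ENNReal.ofReal p) μ + t * yNorm g

/-- The quasi-norm of the real interpolation space `(L^p, Y)_{θ,q}`, namely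
`‖(2^{nθ} K(f, 2^{-n}))_n‖_{ℓ^q}`. -/
def interpNorm (p : ℝ) (μ : Measure Ω) (Y : Set (Ω → ℝ)) (yNorm : (Ω → ℝ) → ℝ≥0∞)
    (θ : ℝ) (q : ℝ≥0∞) (f : Ω → ℝ) : ℝ≥0∞ :=
  lqNorm q (fun n => (2 : ℝ≥0∞) ^ ((n : ℝ) * θ) *
    Kfun p μ Y yNorm f ((2 : ℝ≥0∞) ^ (-(n : ℝ))))

/-- The modulus of smoothness `𝒲_S(f,t)_{σ,p}`; the supremum ranges over all finite
partitions of `Ω` into pairwise disjoint atoms or rings. -/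
def modW {μ : Measure Ω} (F : FiltrationAtoms Ω μ) (S : Submodule ℝ (Ω → ℝ)) (σ p : ℝ)
    (f : Ω → ℝ) (t : ℝ) : ℝ≥0∞ :=
  ⨆ (P : Finset (Set Ω)) (_ : ∀ R ∈ P, F.IsAtomOrRing R)
    (_ : (↑P : Set (Set Ω)).Pairwise Disjoint) (_ : ⋃₀ (↑P : Set (Set Ω)) = Set.univ),
    min (ENNReal.ofReal t) ((P.card : ℝ≥0∞)⁻¹) ^ (1 / σ - 1 / p) *
      (∑ R ∈ P, Ep S p μ f R ^ σ) ^ (1 / σ)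

/-- `h` belongs to `S(ℱ_n)`: on each atom of `ℱ_n`, `h` agrees with some element of `S`. -/
def PiecewiseS {μ : Measure Ω} (F : FiltrationAtoms Ω μ) (S : Submodule ℝ (Ω → ℝ)) (n : ℕ)
    (h : Ω → ℝ) : Prop :=
  ∀ A ∈ F.atoms n, ∃ g ∈ S, Set.EqOn h g A

/-- The near-best approximation operator `W_μ f = ∑_{A ∈ 𝒜_μ} f_A · 1_A` built from a
selection `fA` of near-best approximants on atoms. -/
def Wop {μ : Measure Ω} (F : FiltrationAtoms Ω μ) (fA : (Ω → ℝ) → Set Ω → Ω → ℝ)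
    (f : Ω → ℝ) (n : ℕ) : Ω → ℝ :=
  ∑ A ∈ (F.atoms_finite n).toFinset, A.indicator (fA f A)

end

namespace FiltrationAtoms

variable {Ω : Type} [MeasurableSpace Ω] {μ : Measure Ω} (F : FiltrationAtoms Ω μ)

lemma nonempty_of_mem_atoms {n : ℕ} {A : Set Ω} (hA : A ∈ F.atoms n) : A.Nonempty :=
  nonempty_of_measure_ne_zero (F.atoms_pos n A hA).ne'

lemma exists_mem_atoms (n : ℕ) (x : Ω) : ∃ D ∈ F.atoms n, x ∈ D := by
  have hx : x ∈ ⋃₀ F.atoms n := F.atoms_cover n ▸ mem_univ x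
  simpa using hx

lemma eq_of_mem_atoms {n : ℕ} {D E : Set Ω} (hD : D ∈ F.atoms n) (hE : E ∈ F.atoms n) {x : Ω}
    (hxD : x ∈ D) (hxE : x ∈ E) : D = E := by
  by_contra h
  exact Set.disjoint_left.1 (F.atoms_disjoint n hD hE h) hxD hxE

lemma exists_superset_of_le {k m : ℕ} (hkm : k ≤ m) {B : Set Ω} (hB : B ∈ F.atoms m) :
    ∃ A ∈ F.atoms k, B ⊆ A := by
  induction m, hkm using Nat.le_induction generalizing B with
  | base => exact ⟨B, hB, Subset.rfl⟩
  | succ m _ ih =>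
    obtain ⟨A, hA, hBA⟩ := F.atoms_refine m B hB
    obtain ⟨A', hA', hAA'⟩ := ih hA
    exact ⟨A', hA', hBA.trans hAA'⟩

lemma subset_of_le_of_mem {k m : ℕ} (hkm : k ≤ m) {A B : Set Ω} (hA : A ∈ F.atoms k)
    (hB : B ∈ F.atoms m) {x : Ω} (hxA : x ∈ A) (hxB : x ∈ B) : B ⊆ A := by
  obtain ⟨A', hA', hBA'⟩ := F.exists_superset_of_le hkm hB
  rwa [F.eq_of_mem_atoms hA hA' hxA (hBA' hxB)]

lemma subset_or_subset_of_mem {A B : Set Ω} (hA : A ∈ F.Atoms) (hB : B ∈ F.Atoms) {x : Ω}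
    (hxA : x ∈ A) (hxB : x ∈ B) : A ⊆ B ∨ B ⊆ A := by
  obtain ⟨k, hA⟩ := mem_iUnion.1 hA
  obtain ⟨m, hB⟩ := mem_iUnion.1 hB
  rcases le_total k m with h | h
  · exact Or.inr (F.subset_of_le_of_mem h hA hB hxA hxB)
  · exact Or.inl (F.subset_of_le_of_mem h hB hA hxB hxA)

/-- `U` is a union of atoms of `ℱ_n`. -/
def IsSaturated (n : ℕ) (U : Set Ω) : Prop :=
  ∀ D ∈ F.atoms n, D ⊆ U ∨ Disjoint D U

lemma isSaturated_of_le {k n : ℕ} (hkn : k ≤ n) {A : Set Ω} (hA : A ∈ F.atoms k) :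
    F.IsSaturated n A := by
  intro D hD
  by_cases h : Disjoint D A
  · exact Or.inr h
  · obtain ⟨x, hxD, hxA⟩ := Set.not_disjoint_iff.1 h
    exact Or.inl (F.subset_of_le_of_mem hkn hA hD hxA hxD)

/-- The union of the atoms of `ℱ_n` that meet `R`. -/
def saturation (n : ℕ) (R : Set Ω) : Set Ω :=
  ⋃₀ {D ∈ F.atoms n | (D ∩ R).Nonempty}

lemma subset_saturation (n : ℕ) (R : Set Ω) : R ⊆ F.saturation n R := by
  intro x hx
  obtain ⟨D, hD, hxD⟩ := F.exists_mem_atoms n x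
  exact ⟨D, ⟨hD, x, hxD, hx⟩, hxD⟩

lemma measurableSet_saturation (n : ℕ) (R : Set Ω) : MeasurableSet (F.saturation n R) :=
  MeasurableSet.sUnion ((F.atoms_finite n).subset (sep_subset _ _)).countable
    fun D hD => F.atoms_measurable n D hD.1

lemma isSaturated_saturation (n : ℕ) (R : Set Ω) : F.IsSaturated n (F.saturation n R) := by
  intro D hD
  by_cases h : (D ∩ R).Nonempty
  · exact Or.inl (subset_sUnion_of_mem ⟨hD, h⟩)
  · refine Or.inr (Set.disjoint_left.2 ?_)
    rintro x hxD ⟨E, ⟨hE, hER⟩, hxE⟩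
    exact h (F.eq_of_mem_atoms hD hE hxD hxE ▸ hER)

/-- An atom or ring not contained in a single atom of `ℱ_n` has the form `A \ B` with `A` an
`ℱ_n`-saturated atom and `B` empty or an atom. -/
lemma IsAtomOrRing.exists_eq_diff {n : ℕ} {R : Set Ω} (hR : F.IsAtomOrRing R)
    (hRn : ∀ D ∈ F.atoms n, ¬ R ⊆ D) :
    ∃ A ∈ F.Atoms, F.IsSaturated n A ∧
      ∃ B, (B = ∅ ∨ B ∈ F.Atoms) ∧ B ⊆ A ∧ R = A \ B := by
  have aux : ∀ A ∈ F.Atoms, R ⊆ A → F.IsSaturated n A := by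
    intro A hA hRA
    obtain ⟨k, hA⟩ := mem_iUnion.1 hA
    rcases le_total k n with h | h
    · exact F.isSaturated_of_le h hA
    · obtain ⟨D, hD, hAD⟩ := F.exists_superset_of_le h hA
      exact absurd (hRA.trans hAD) (hRn D hD)
  rcases hR with hR | ⟨A, hA, B, hB, hBA, hRAB, -⟩
  · exact ⟨R, hR, aux R hR Subset.rfl, ∅, Or.inl rfl, empty_subset _, by simp⟩
  · exact ⟨A, hA, aux A hA (hRAB ▸ sdiff_subset), B, Or.inr hB, hBA, hRAB⟩

/-- If an atom `D` of `ℱ_n` meets `B` without being contained in it, then `B ⊆ D`. -/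
lemma subset_of_mem_of_not_subset {n : ℕ} {B D : Set Ω} (hB : B = ∅ ∨ B ∈ F.Atoms)
    (hD : D ∈ F.atoms n) {x : Ω} (hxB : x ∈ B) (hxD : x ∈ D) (hDB : ¬ D ⊆ B) : B ⊆ D := by
  rcases hB with rfl | hB
  · exact empty_subset _
  · exact (F.subset_or_subset_of_mem hB (mem_iUnion.2 ⟨n, hD⟩) hxB hxD).resolve_right hDB

lemma IsAtomOrRing.saturation {n : ℕ} {R : Set Ω} (hR : F.IsAtomOrRing R)
    (hRn : ∀ D ∈ F.atoms n, ¬ R ⊆ D) : F.IsAtomOrRing (F.saturation n R) := by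
  obtain ⟨A, hA, hAn, B, hB, hBA, hRAB⟩ := IsAtomOrRing.exists_eq_diff F hR hRn
  have hsub : F.saturation n R ⊆ A := by
    rintro x ⟨D, ⟨hD, y, hyD, hyR⟩, hxD⟩
    rcases hAn D hD with h | h
    · exact h hxD
    · rw [hRAB] at hyR
      exact absurd hyR.1 (Set.disjoint_left.1 h hyD)
  by_cases h : ∃ D ∈ F.atoms n, (D ∩ B).Nonempty ∧ ¬ D ⊆ B
  · obtain ⟨D, hD, ⟨x, hxD, hxB⟩, hDB⟩ := h
    have hBD : B ⊆ D := F.subset_of_mem_of_not_subset hB hD hxB hxD hDB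
    have hDA : D ⊆ A :=
      (hAn D hD).resolve_right fun h => Set.disjoint_left.1 h hxD (hBA hxB)
    obtain ⟨z, hzD, hzB⟩ := not_subset.1 hDB
    have hDR : D ⊆ F.saturation n R :=
      subset_sUnion_of_mem ⟨hD, z, hzD, hRAB ▸ ⟨hDA hzD, hzB⟩⟩
    have : F.saturation n R = A := by
      refine hsub.antisymm fun y hy => ?_
      by_cases hyB : y ∈ B
      · exact hDR (hBD hyB)
      · exact F.subset_saturation n R (hRAB ▸ ⟨hy, hyB⟩)
    rw [this]
    exact Or.inl hA
  · push Not at h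
    have : F.saturation n R = R := by
      refine Subset.antisymm ?_ (F.subset_saturation n R)
      rintro x ⟨D, ⟨hD, y, hyD, hyR⟩, hxD⟩
      have hx : x ∈ A := hsub ⟨D, ⟨hD, y, hyD, hyR⟩, hxD⟩
      rw [hRAB] at hyR ⊢
      exact ⟨hx, fun hxB => hyR.2 (h D hD ⟨x, hxD, hxB⟩ hyD)⟩
    rw [this]
    exact hR

lemma disjoint_saturation {n : ℕ} {R Q : Set Ω} (hR : F.IsAtomOrRing R) (hQ : F.IsAtomOrRing Q)
    (hRn : ∀ D ∈ F.atoms n, ¬ R ⊆ D) (hQn : ∀ D ∈ F.atoms n, ¬ Q ⊆ D) (hRQ : Disjoint R Q) :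
    Disjoint (F.saturation n R) (F.saturation n Q) := by
  obtain ⟨A, hA, hAn, B, hB, hBA, rfl⟩ := IsAtomOrRing.exists_eq_diff F hR hRn
  obtain ⟨A', hA', hAn', B', hB', hBA', rfl⟩ := IsAtomOrRing.exists_eq_diff F hQ hQn
  rw [Set.disjoint_left] at hRQ ⊢
  rintro x ⟨D, ⟨hD, y, hyD, hyA, hyB⟩, hxD⟩ ⟨E, ⟨hE, z, hzE, hzA, hzB⟩, hxE⟩
  obtain rfl := F.eq_of_mem_atoms hD hE hxD hxE
  have hDA : D ⊆ A := (hAn D hD).resolve_right fun h => Set.disjoint_left.1 h hyD hyA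
  have hDA' : D ⊆ A' := (hAn' D hD).resolve_right fun h => Set.disjoint_left.1 h hzE hzA
  have hzB₁ : z ∈ B := by
    by_contra h
    exact hRQ ⟨hDA hzE, h⟩ ⟨hzA, hzB⟩
  have hyB₁ : y ∈ B' := by
    by_contra h
    exact hRQ ⟨hyA, hyB⟩ ⟨hDA' hyD, h⟩
  have hBD : B ⊆ D := F.subset_of_mem_of_not_subset hB hD hzB₁ hzE fun h => hyB (h hyD)
  have hBD' : B' ⊆ D := F.subset_of_mem_of_not_subset hB' hD hyB₁ hyD fun h => hzB (h hzE)
  rcases F.subset_or_subset_of_mem hA hA' hyA (hDA' hyD) with h | h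
  · obtain ⟨w, hw, hwD⟩ := not_subset.1 (hRn D hD)
    exact hRQ hw ⟨h hw.1, fun hwB => hwD (hBD' hwB)⟩
  · obtain ⟨w, hw, hwD⟩ := not_subset.1 (hQn D hD)
    exact hRQ ⟨h hw.1, fun hwB => hwD (hBD hwB)⟩ hw

end FiltrationAtoms

section PiecewiseFunctions

variable {Ω : Type} [MeasurableSpace Ω] {μ : Measure Ω} {F : FiltrationAtoms Ω μ}
  {S : Submodule ℝ (Ω → ℝ)} {n : ℕ} {h k : Ω → ℝ}

lemma piecewiseS_of_mem (hh : h ∈ S) : PiecewiseS F S n h :=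
  fun _ _ => ⟨h, hh, fun _ _ => rfl⟩

lemma PiecewiseS.add (hh : PiecewiseS F S n h) (hk : PiecewiseS F S n k) :
    PiecewiseS F S n (h + k) := by
  intro A hA
  obtain ⟨g, hg, hgA⟩ := hh A hA
  obtain ⟨g', hg', hgA'⟩ := hk A hA
  exact ⟨g + g', S.add_mem hg hg', fun x hx => congrArg₂ (· + ·) (hgA hx) (hgA' hx)⟩

lemma PiecewiseS.sub (hh : PiecewiseS F S n h) (hk : PiecewiseS F S n k) :
    PiecewiseS F S n (h - k) := by
  intro A hA
  obtain ⟨g, hg, hgA⟩ := hh A hA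
  obtain ⟨g', hg', hgA'⟩ := hk A hA
  exact ⟨g - g', S.sub_mem hg hg', fun x hx => congrArg₂ (· - ·) (hgA hx) (hgA' hx)⟩

lemma PiecewiseS.smul (c : ℝ) (hh : PiecewiseS F S n h) : PiecewiseS F S n (c • h) := by
  intro A hA
  obtain ⟨g, hg, hgA⟩ := hh A hA
  exact ⟨c • g, S.smul_mem c hg, fun x hx => congrArg (c * ·) (hgA hx)⟩

lemma PiecewiseS.sum {ι : Type*} (s : Finset ι) {u : ι → Ω → ℝ}
    (hu : ∀ i ∈ s, PiecewiseS F S n (u i)) : PiecewiseS F S n (∑ i ∈ s, u i) :=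
  Finset.sum_induction u (PiecewiseS F S n) (fun _ _ => PiecewiseS.add)
    (piecewiseS_of_mem S.zero_mem) hu

lemma PiecewiseS.indicator {U : Set Ω} (hU : F.IsSaturated n U) (hh : PiecewiseS F S n h) :
    PiecewiseS F S n (U.indicator h) := by
  intro A hA
  rcases hU A hA with hAU | hAU
  · obtain ⟨g, hg, hgA⟩ := hh A hA
    exact ⟨g, hg, fun x hx => by rw [indicator_of_mem (hAU hx), hgA hx]⟩
  · exact ⟨0, S.zero_mem, fun x hx =>
      indicator_of_notMem (Set.disjoint_left.1 hAU hx) h⟩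

lemma PiecewiseS.memLp_top (hSmeas : ∀ g ∈ S, Measurable g)
    (hSbdd : ∀ g ∈ S, eLpNormEssSup g μ ≠ ∞) (hh : PiecewiseS F S n h) : MemLp h ∞ μ := by
  have hrep : h = ∑ A ∈ (F.atoms_finite n).toFinset, A.indicator h := by
    ext x
    obtain ⟨D, hD, hxD⟩ := F.exists_mem_atoms n x
    rw [Finset.sum_apply, Finset.sum_eq_single_of_mem D (by simpa using hD),
      indicator_of_mem hxD]
    intro E hE hED
    refine indicator_of_notMem (fun hxE => hED ?_) h
    exact F.eq_of_mem_atoms ((F.atoms_finite n).mem_toFinset.1 hE) hD hxE hxD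
  rw [hrep]
  refine memLp_finsetSum' _ fun A hA => ?_
  rw [Set.Finite.mem_toFinset] at hA
  obtain ⟨g, hg, hgA⟩ := hh A hA
  rw [indicator_congr hgA]
  refine MemLp.indicator (F.atoms_measurable n A hA) ⟨(hSmeas g hg).aestronglyMeasurable, ?_⟩
  rw [eLpNorm_exponent_top]
  exact (hSbdd g hg).lt_top

lemma eventually_piecewiseS_of_mem_sigmaN {m : ℕ} {y : Ω → ℝ} (hy : y ∈ SigmaN (dictC F S) m) :
    ∀ᶠ n in atTop, PiecewiseS F S n y := by
  obtain ⟨c, x, hx, rfl⟩ := hy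
  have : ∀ᶠ n in atTop, ∀ j, PiecewiseS F S n (x j) := by
    refine eventually_all.2 fun j => ?_
    obtain ⟨g, hg, A, hA, hxj⟩ := hx j
    obtain ⟨k, hA⟩ := mem_iUnion.1 hA
    filter_upwards [eventually_ge_atTop k] with n hn
    rw [hxj]
    exact (piecewiseS_of_mem hg).indicator (F.isSaturated_of_le hn hA)
  filter_upwards [this] with n hn
  exact PiecewiseS.sum _ fun j _ => (hn j).smul (c j)

lemma ae_eq_of_forall_integral_sub_mul_eq_zero [IsFiniteMeasure μ]
    (hSmeas : ∀ g ∈ S, Measurable g) (hSbdd : ∀ g ∈ S, eLpNormEssSup g μ ≠ ∞)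
    {f : Ω → ℝ} (hf : Integrable f μ) (hh : PiecewiseS F S n h) (hk : PiecewiseS F S n k)
    (hfh : ∀ φ, PiecewiseS F S n φ → ∫ ω, (f ω - h ω) * φ ω ∂μ = 0)
    (hfk : ∀ φ, PiecewiseS F S n φ → ∫ ω, (f ω - k ω) * φ ω ∂μ = 0) : h =ᵐ[μ] k := by
  have hφ := hh.sub hk
  have hφb := hφ.memLp_top hSmeas hSbdd
  have hhi : Integrable h μ := (hh.memLp_top hSmeas hSbdd).integrable le_top
  have hki : Integrable k μ := (hk.memLp_top hSmeas hSbdd).integrable le_top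
  have hi₁ : Integrable (fun ω => (f ω - h ω) * (h - k) ω) μ :=
    (hf.sub hhi).mul_of_top_left hφb
  have hi₂ : Integrable (fun ω => (f ω - k ω) * (h - k) ω) μ :=
    (hf.sub hki).mul_of_top_left hφb
  have hsq : (fun ω => (f ω - k ω) * (h - k) ω - (f ω - h ω) * (h - k) ω) =
      fun ω => (h ω - k ω) * (h ω - k ω) := by
    ext ω
    simp only [Pi.sub_apply]
    ring
  have hi : Integrable (fun ω => (h ω - k ω) * (h ω - k ω)) μ := hsq ▸ hi₂.sub hi₁
  have h0 : ∫ ω, (h ω - k ω) * (h ω - k ω) ∂μ = 0 := by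
    rw [← hsq, integral_sub hi₂ hi₁, hfk _ hφ, hfh _ hφ, sub_zero]
  rw [integral_eq_zero_iff_of_nonneg (fun ω => mul_self_nonneg _) hi] at h0
  filter_upwards [h0] with ω hω
  exact sub_eq_zero.1 (mul_self_eq_zero.1 hω)

end PiecewiseFunctions

section Ep

variable {Ω : Type} [MeasurableSpace Ω] {μ : Measure Ω} {F : FiltrationAtoms Ω μ}
  {S : Submodule ℝ (Ω → ℝ)} {p : ℝ}

lemma Ep_mono_set (f : Ω → ℝ) {R U : Set Ω} (hRU : R ⊆ U) : Ep S p μ f R ≤ Ep S p μ f U :=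
  iInf₂_mono fun _ _ => eLpNorm_mono_measure _ (Measure.restrict_mono hRU le_rfl)

lemma Ep_le_add (hp : 1 ≤ p) (hSmeas : ∀ g ∈ S, Measurable g) {f h : Ω → ℝ}
    (hf : AEStronglyMeasurable f μ) (hh : AEStronglyMeasurable h μ) (R : Set Ω) :
    Ep S p μ f R ≤ Ep S p μ h R + eLpNorm (f - h) (ENNReal.ofReal p) μ := by
  rw [Ep, Ep, ENNReal.iInf_add]
  refine le_iInf fun g => ?_
  rw [ENNReal.iInf_add]
  refine le_iInf fun hg => (iInf₂_le g hg).trans ?_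
  have hfg : f - g = (h - g) + (f - h) := by abel
  rw [hfg]
  refine (eLpNorm_add_le (hh.sub (hSmeas g hg).aestronglyMeasurable).restrict
    (hf.sub hh).restrict (ENNReal.one_le_ofReal.2 hp)).trans ?_
  gcongr
  exact Measure.restrict_le_self

lemma Ep_eq_zero_of_subset_atom {n : ℕ} {h : Ω → ℝ} (hh : PiecewiseS F S n h) {R D : Set Ω}
    (hD : D ∈ F.atoms n) (hRD : R ⊆ D) : Ep S p μ h R = 0 := by
  obtain ⟨g, hg, hgD⟩ := hh D hD
  refine le_antisymm ((Ep_mono_set h hRD).trans ((iInf₂_le g hg).trans ?_)) zero_le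
  have : h - g =ᵐ[μ.restrict D] 0 := by
    filter_upwards [ae_restrict_mem (F.atoms_measurable n D hD)] with x hx
    simp [hgD hx]
  rw [eLpNorm_congr_ae this, eLpNorm_zero]

lemma tendsto_Ep (hp : 1 ≤ p) (hSmeas : ∀ g ∈ S, Measurable g) {f : Ω → ℝ} {u : ℕ → Ω → ℝ}
    (hf : AEStronglyMeasurable f μ) (hu : ∀ n, AEStronglyMeasurable (u n) μ)
    (hlim : Tendsto (fun n => eLpNorm (f - u n) (ENNReal.ofReal p) μ) atTop (nhds 0))
    (R : Set Ω) : Tendsto (fun n => Ep S p μ (u n) R) atTop (nhds (Ep S p μ f R)) := by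
  have hlow := ENNReal.Tendsto.sub (tendsto_const_nhds (x := Ep S p μ f R)) hlim
    (Or.inr ENNReal.zero_ne_top)
  have hup := (tendsto_const_nhds (x := Ep S p μ f R)).add hlim
  rw [tsub_zero] at hlow
  rw [add_zero] at hup
  refine tendsto_of_tendsto_of_tendsto_of_le_of_le hlow hup (fun n => ?_) (fun n => ?_)
  · exact tsub_le_iff_right.2 (Ep_le_add hp hSmeas hf (hu n) R)
  · change _ ≤ Ep S p μ f R + eLpNorm (f - u n) (ENNReal.ofReal p) μ
    rw [eLpNorm_sub_comm]
    exact Ep_le_add hp hSmeas (hu n) hf R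

lemma varSeminorm_le_liminf (hp : 1 ≤ p) {σ : ℝ} (hSmeas : ∀ g ∈ S, Measurable g)
    {f : Ω → ℝ} {u : ℕ → Ω → ℝ}
    (hf : AEStronglyMeasurable f μ) (hu : ∀ n, AEStronglyMeasurable (u n) μ)
    (hlim : Tendsto (fun n => eLpNorm (f - u n) (ENNReal.ofReal p) μ) atTop (nhds 0)) :
    varSeminorm F S σ p f ≤ liminf (fun n => varSeminorm F S σ p (u n)) atTop := by
  refine iSup_le fun T => iSup_le fun hT => iSup_le fun hTd => ?_
  have hT_lim : Tendsto (fun n => (∑ R ∈ T, Ep S p μ (u n) R ^ σ) ^ (1 / σ)) atTop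
      (nhds ((∑ R ∈ T, Ep S p μ f R ^ σ) ^ (1 / σ))) :=
    (ENNReal.continuous_rpow_const.tendsto _).comp <| tendsto_finsetSum _ fun R _ =>
      (ENNReal.continuous_rpow_const.tendsto _).comp (tendsto_Ep hp hSmeas hf hu hlim R)
  rw [← hT_lim.liminf_eq]
  refine liminf_le_liminf (Eventually.of_forall fun n => ?_)
  exact le_iSup_of_le T (le_iSup_of_le hT (le_iSup_of_le hTd le_rfl))

end Ep

section Projection

variable {Ω : Type} [MeasurableSpace Ω] {μ : Measure Ω} [IsFiniteMeasure μ]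
  {F : FiltrationAtoms Ω μ} {S : Submodule ℝ (Ω → ℝ)} {p : ℝ} {n : ℕ}
  {Q : (Ω → ℝ) → Ω → ℝ} {M : ℝ}

lemma projection_ae_eq (hSmeas : ∀ g ∈ S, Measurable g)
    (hSbdd : ∀ g ∈ S, eLpNormEssSup g μ ≠ ∞) (hQrange : ∀ f, PiecewiseS F S n (Q f))
    (hQorth : ∀ f : Ω → ℝ, AEMeasurable f μ → ∀ h : Ω → ℝ,
      PiecewiseS F S n h → ∫ ω, (f ω - Q f ω) * h ω ∂μ = 0)
    {f k : Ω → ℝ} (hf : Integrable f μ) (hk : PiecewiseS F S n k)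
    (hfk : ∀ φ, PiecewiseS F S n φ → ∫ ω, (f ω - k ω) * φ ω ∂μ = 0) : Q f =ᵐ[μ] k :=
  ae_eq_of_forall_integral_sub_mul_eq_zero hSmeas hSbdd hf (hQrange f) hk
    (hQorth f hf.aemeasurable) hfk

lemma eLpNorm_projection_sub_le (hSmeas : ∀ g ∈ S, Measurable g)
    (hSbdd : ∀ g ∈ S, eLpNormEssSup g μ ≠ ∞) (hQrange : ∀ f, PiecewiseS F S n (Q f))
    (hQorth : ∀ f : Ω → ℝ, AEMeasurable f μ → ∀ h : Ω → ℝ,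
      PiecewiseS F S n h → ∫ ω, (f ω - Q f ω) * h ω ∂μ = 0)
    (hQbdd : ∀ f, eLpNorm (Q f) (ENNReal.ofReal p) μ ≤
      ENNReal.ofReal M * eLpNorm f (ENNReal.ofReal p) μ)
    {f y : Ω → ℝ} (hf : Integrable f μ) (hy : PiecewiseS F S n y) {U : Set Ω}
    (hU : MeasurableSet U) (hUn : F.IsSaturated n U) :
    eLpNorm (Q f - y) (ENNReal.ofReal p) (μ.restrict U) ≤
      ENNReal.ofReal M * eLpNorm (f - y) (ENNReal.ofReal p) (μ.restrict U) := by
  have hyi : Integrable y μ := (hy.memLp_top hSmeas hSbdd).integrable le_top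
  have hQ : Q (U.indicator (f - y)) =ᵐ[μ] U.indicator (Q f - y) := by
    refine projection_ae_eq hSmeas hSbdd hQrange hQorth ((hf.sub hyi).indicator hU)
      (((hQrange f).sub hy).indicator hUn) fun φ hφ => ?_
    rw [← hQorth f hf.aemeasurable _ (hφ.indicator hUn)]
    refine integral_congr_ae (Eventually.of_forall fun ω => ?_)
    by_cases hω : ω ∈ U <;> simp [hω]
  rw [← eLpNorm_indicator_eq_eLpNorm_restrict hU, ← eLpNorm_indicator_eq_eLpNorm_restrict hU,
    ← eLpNorm_congr_ae hQ]
  exact hQbdd _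

lemma Ep_projection_le (hSmeas : ∀ g ∈ S, Measurable g)
    (hSbdd : ∀ g ∈ S, eLpNormEssSup g μ ≠ ∞) (hQrange : ∀ f, PiecewiseS F S n (Q f))
    (hQorth : ∀ f : Ω → ℝ, AEMeasurable f μ → ∀ h : Ω → ℝ,
      PiecewiseS F S n h → ∫ ω, (f ω - Q f ω) * h ω ∂μ = 0)
    (hQbdd : ∀ f, eLpNorm (Q f) (ENNReal.ofReal p) μ ≤
      ENNReal.ofReal M * eLpNorm f (ENNReal.ofReal p) μ) (hM : 0 < M)
    {f : Ω → ℝ} (hf : Integrable f μ) {U : Set Ω}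
    (hU : MeasurableSet U) (hUn : F.IsSaturated n U) :
    Ep S p μ (Q f) U ≤ ENNReal.ofReal M * Ep S p μ f U := by
  have hM' : ENNReal.ofReal M ≠ 0 := (ENNReal.ofReal_pos.2 hM).ne'
  simp_rw [Ep, ENNReal.mul_iInf_of_ne hM' ENNReal.ofReal_ne_top]
  exact iInf₂_mono fun g hg => eLpNorm_projection_sub_le hSmeas hSbdd hQrange hQorth hQbdd hf
    (piecewiseS_of_mem hg) hU hUn

lemma varSeminorm_projection_le (hSmeas : ∀ g ∈ S, Measurable g)
    (hSbdd : ∀ g ∈ S, eLpNormEssSup g μ ≠ ∞) (hQrange : ∀ f, PiecewiseS F S n (Q f))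
    (hQorth : ∀ f : Ω → ℝ, AEMeasurable f μ → ∀ h : Ω → ℝ,
      PiecewiseS F S n h → ∫ ω, (f ω - Q f ω) * h ω ∂μ = 0)
    (hQbdd : ∀ f, eLpNorm (Q f) (ENNReal.ofReal p) μ ≤
      ENNReal.ofReal M * eLpNorm f (ENNReal.ofReal p) μ) (hM : 0 < M)
    {σ : ℝ} (hσ : 0 < σ) {f : Ω → ℝ} (hf : Integrable f μ) :
    varSeminorm F S σ p (Q f) ≤ ENNReal.ofReal M * varSeminorm F S σ p f := by
  refine iSup_le fun T => iSup_le fun hT => iSup_le fun hTd => ?_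
  set T₁ : Finset (Set Ω) := T.filter fun R => ∀ D ∈ F.atoms n, ¬ R ⊆ D with hT₁
  have hmem : ∀ R ∈ T₁, R ∈ T ∧ ∀ D ∈ F.atoms n, ¬ R ⊆ D := fun R hR => Finset.mem_filter.1 hR
  have hdisj : ∀ R ∈ T₁, ∀ R' ∈ T₁, R ≠ R' →
      Disjoint (F.saturation n R) (F.saturation n R') := fun R hR R' hR' hne =>
    F.disjoint_saturation (hT R (hmem R hR).1) (hT R' (hmem R' hR').1) (hmem R hR).2
      (hmem R' hR').2 (hTd (hmem R hR).1 (hmem R' hR').1 hne)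
  have hinj : Set.InjOn (F.saturation n) (T₁ : Set (Set Ω)) := by
    intro R hR R' hR' heq
    by_contra hne
    have hd := hdisj R hR R' hR' hne
    rw [← heq, disjoint_self, Set.bot_eq_empty] at hd
    have hRe : R = ∅ := subset_empty_iff.1 (hd ▸ F.subset_saturation n R)
    have hRe' : R' = ∅ := subset_empty_iff.1 (hd ▸ heq ▸ F.subset_saturation n R')
    exact hne (hRe.trans hRe'.symm)
  set T₂ := T₁.image (F.saturation n) with hT₂
  have hsum : ∑ R ∈ T, Ep S p μ (Q f) R ^ σ ≤
      ENNReal.ofReal M ^ σ * ∑ R ∈ T₂, Ep S p μ f R ^ σ := by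
    rw [hT₂, Finset.sum_image hinj, Finset.mul_sum,
      ← Finset.sum_filter_add_sum_filter_not T (fun R => ∀ D ∈ F.atoms n, ¬ R ⊆ D), ← hT₁]
    have h0 : ∑ R ∈ T with ¬ ∀ D ∈ F.atoms n, ¬ R ⊆ D, Ep S p μ (Q f) R ^ σ = 0 := by
      refine Finset.sum_eq_zero fun R hR => ?_
      have hR' := (Finset.mem_filter.1 hR).2
      push Not at hR'
      obtain ⟨D, hD, hRD⟩ := hR'
      rw [Ep_eq_zero_of_subset_atom (hQrange f) hD hRD, ENNReal.zero_rpow_of_pos hσ]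
    rw [h0, add_zero]
    refine Finset.sum_le_sum fun R _ => ?_
    rw [← ENNReal.mul_rpow_of_nonneg _ _ hσ.le]
    refine ENNReal.rpow_le_rpow ((Ep_mono_set _ (F.subset_saturation n R)).trans ?_) hσ.le
    exact Ep_projection_le hSmeas hSbdd hQrange hQorth hQbdd hM hf
      (F.measurableSet_saturation n R) (F.isSaturated_saturation n R)
  have hT₂ring : ∀ R ∈ T₂, F.IsAtomOrRing R := by
    intro R hR
    obtain ⟨R', hR', rfl⟩ := Finset.mem_image.1 hR
    exact FiltrationAtoms.IsAtomOrRing.saturation F (hT R' (hmem R' hR').1) (hmem R' hR').2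
  have hT₂d : (T₂ : Set (Set Ω)).Pairwise Disjoint := by
    intro R hR R' hR' hne
    obtain ⟨R₁, hR₁, rfl⟩ := Finset.mem_image.1 hR
    obtain ⟨R₂, hR₂, rfl⟩ := Finset.mem_image.1 hR'
    exact hdisj R₁ hR₁ R₂ hR₂ fun h => hne (h ▸ rfl)
  calc (∑ R ∈ T, Ep S p μ (Q f) R ^ σ) ^ (1 / σ)
      ≤ (ENNReal.ofReal M ^ σ * ∑ R ∈ T₂, Ep S p μ f R ^ σ) ^ (1 / σ) :=
        ENNReal.rpow_le_rpow hsum (by positivity)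
    _ = ENNReal.ofReal M * (∑ R ∈ T₂, Ep S p μ f R ^ σ) ^ (1 / σ) := by
        rw [ENNReal.mul_rpow_of_nonneg _ _ (by positivity), ← ENNReal.rpow_mul,
          mul_one_div_cancel hσ.ne', ENNReal.rpow_one]
    _ ≤ ENNReal.ofReal M * varSeminorm F S σ p f := by
        gcongr
        exact le_iSup_of_le T₂ (le_iSup_of_le hT₂ring (le_iSup_of_le hT₂d le_rfl))

lemma tendsto_eLpNorm_sub_projection (hp : 1 ≤ p) (hSmeas : ∀ g ∈ S, Measurable g)
    (hSbdd : ∀ g ∈ S, eLpNormEssSup g μ ≠ ∞) {P : ℕ → (Ω → ℝ) → Ω → ℝ}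
    (hPrange : ∀ f n, PiecewiseS F S n (P n f))
    (hPorth : ∀ f : Ω → ℝ, AEMeasurable f μ → ∀ (n : ℕ) (h : Ω → ℝ),
      PiecewiseS F S n h → ∫ ω, (f ω - P n f ω) * h ω ∂μ = 0)
    (hPbdd : ∀ f n, eLpNorm (P n f) (ENNReal.ofReal p) μ ≤
      ENNReal.ofReal M * eLpNorm f (ENNReal.ofReal p) μ)
    {f : Ω → ℝ} (hf : Integrable f μ) (hfS : MemLpS F S p f) :
    Tendsto (fun n => eLpNorm (f - P n f) (ENNReal.ofReal p) μ) atTop (nhds 0) := by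
  rw [ENNReal.tendsto_nhds_zero]
  intro ε hε
  set C : ℝ≥0∞ := 1 + ENNReal.ofReal M with hC
  have hC0 : C ≠ 0 := by simp [hC]
  have hCtop : C ≠ ∞ := by simp [hC]
  obtain ⟨m, y, hy, hfy⟩ := hfS.2.2 (ε / C) (ENNReal.div_pos hε.ne' hCtop)
  filter_upwards [eventually_piecewiseS_of_mem_sigmaN hy] with n hn
  have hym := (hn.memLp_top hSmeas hSbdd).1
  have hPm := ((hPrange f n).memLp_top hSmeas hSbdd).1
  have hle := eLpNorm_projection_sub_le hSmeas hSbdd (fun f => hPrange f n)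
    (fun f hf => hPorth f hf n) (fun f => hPbdd f n) hf hn MeasurableSet.univ
    (fun D _ => Or.inl (subset_univ D))
  rw [Measure.restrict_univ] at hle
  have hsplit : f - P n f = (f - y) + (y - P n f) := by abel
  calc eLpNorm (f - P n f) (ENNReal.ofReal p) μ
      ≤ eLpNorm (f - y) (ENNReal.ofReal p) μ + eLpNorm (y - P n f) (ENNReal.ofReal p) μ := by
        rw [hsplit]
        exact eLpNorm_add_le (hf.1.sub hym) (hym.sub hPm) (ENNReal.one_le_ofReal.2 hp)
    _ ≤ C * eLpNorm (f - y) (ENNReal.ofReal p) μ := by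
        rw [hC, add_mul, one_mul, eLpNorm_sub_comm y]
        gcongr
    _ ≤ C * (ε / C) := by gcongr
    _ = ε := ENNReal.mul_div_cancel hC0 hCtop

end Projection


/-- Let `1 ≤ p < ∞`, `0 < σ < p`, and let `P_μ` be the orthogonal
projections onto `S_μ = S(ℱ_μ)`, bounded on `L^p` with constant `M`. Then for every
`f ∈ L^p(S)`:
`|f|_{V_{σ,p}} ≤ liminf_μ |P_μ f|_{V_{σ,p}} ≤ limsup_μ |P_μ f|_{V_{σ,p}}
  ≤ sup_μ |P_μ f|_{V_{σ,p}} ≤ M |f|_{V_{σ,p}}`, with the same constant `M`. -/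
theorem statement10
    {Ω : Type} [MeasurableSpace Ω] {μ : Measure Ω} [IsProbabilityMeasure μ]
    (F : FiltrationAtoms Ω μ) (ν : ℕ) (hν : 2 ≤ ν) (hFν : F.IsNuAry ν)
    (S : Submodule ℝ (Ω → ℝ)) (hSfin : Module.Finite ℝ S)
    (hSmeas : ∀ g ∈ S, Measurable g) (hSbdd : ∀ g ∈ S, eLpNormEssSup g μ ≠ ∞)
    (hstab : StabilityCondition F S)
    (σ p : ℝ) (hσ : 0 < σ) (hσp : σ < p) (hp1 : 1 ≤ p)
    (P : ℕ → (Ω → ℝ) → Ω → ℝ)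
    (hPrange : ∀ (f : Ω → ℝ) (n : ℕ), PiecewiseS F S n (P n f))
    (hPorth : ∀ (f : Ω → ℝ), AEMeasurable f μ → ∀ (n : ℕ) (h : Ω → ℝ),
      PiecewiseS F S n h → ∫ ω, (f ω - P n f ω) * h ω ∂μ = 0)
    (M : ℝ) (hM0 : 0 < M)
    (hPbdd : ∀ (f : Ω → ℝ) (n : ℕ),
      eLpNorm (P n f) (ENNReal.ofReal p) μ ≤
        ENNReal.ofReal M * eLpNorm f (ENNReal.ofReal p) μ) :
    ∀ f : Ω → ℝ, MemLpS F S p f →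
      varSeminorm F S σ p f ≤
        Filter.liminf (fun n => varSeminorm F S σ p (P n f)) atTop ∧
      Filter.liminf (fun n => varSeminorm F S σ p (P n f)) atTop ≤
        Filter.limsup (fun n => varSeminorm F S σ p (P n f)) atTop ∧
      Filter.limsup (fun n => varSeminorm F S σ p (P n f)) atTop ≤
        (⨆ n, varSeminorm F S σ p (P n f)) ∧
      (⨆ n, varSeminorm F S σ p (P n f)) ≤ ENNReal.ofReal M * varSeminorm F S σ p f := by
  intro f hfS
  have hf : Integrable f μ :=
    MemLp.integrable (ENNReal.one_le_ofReal.2 hp1)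
      ⟨hfS.1.aestronglyMeasurable, hfS.2.1.lt_top⟩
  refine ⟨varSeminorm_le_liminf hp1 hSmeas hf.1
    (fun n => ((hPrange f n).memLp_top hSmeas hSbdd).1)
    (tendsto_eLpNorm_sub_projection hp1 hSmeas hSbdd hPrange hPorth hPbdd hf hfS),
    liminf_le_limsup, limsup_le_iSup, iSup_le fun n => ?_⟩
  exact varSeminorm_projection_le hSmeas hSbdd (fun f => hPrange f n)
    (fun f hf => hPorth f hf n) (fun f => hPbdd f n) hM0 hσ hf
end

section
/- For every choice of parameters 0 < σ < p < ∞, the variation space V_{σ,p}(S) for S = span{1_{[0,1]}} and the dyadic filtration (𝒟_n) on [0,1], equipped with the norm ‖f‖_p + |f|_{V_{σ,p}}, is not separable. -/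
open MeasureTheory ENNReal Set Filter
open scoped ENNReal NNReal Classical

noncomputable section

/-- A dyadic atom: a dyadic subinterval `[k/2^n, (k+1)/2^n)` of `[0,1)`. -/
def dyAtom (A : Set ℝ) : Prop :=
  ∃ n k : ℕ, k < 2 ^ n ∧ A = Set.Ico ((k : ℝ) / 2 ^ n) (((k : ℝ) + 1) / 2 ^ n)

/-- A dyadic atom or a nonempty ring `A \ B` of two nested dyadic atoms. -/
def dyAtomOrRing (R : Set ℝ) : Prop :=
  dyAtom R ∨ ∃ A B : Set ℝ, dyAtom A ∧ dyAtom B ∧ B ⊆ A ∧ R = A \ B ∧ R.Nonempty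

/-- `E_p(f,R)` for `S = span{1}`: the best `L^p(R)`-approximation of `f` by constants. -/
def EpD (p : ℝ) (f : ℝ → ℝ) (R : Set ℝ) : ℝ≥0∞ :=
  ⨅ c : ℝ, eLpNorm (fun t => f t - c) (ENNReal.ofReal p) (volume.restrict R)

/-- The dyadic ring-variation seminorm `|f|_{V_{σ,p}}`. -/
def varD (σ p : ℝ) (f : ℝ → ℝ) : ℝ≥0∞ :=
  ⨆ (P : Finset (Set ℝ)) (_ : ∀ R ∈ P, dyAtomOrRing R)
    (_ : (↑P : Set (Set ℝ)).Pairwise Disjoint),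
    (∑ R ∈ P, EpD p f R ^ σ) ^ (1 / σ)

/-- The `n`-th Rademacher function (equal a.e. to `sign (sin (2^n π t))`):
`𝒟_n`-measurable with values `±1`. -/
def rademacher (n : ℕ) (t : ℝ) : ℝ :=
  if Even ⌊(2 : ℝ) ^ n * t⌋ then 1 else -1

/-- The function `f_Λ = ∑_{j ∈ Λ} 2^{-jβ} r_j`. -/
def fLam (β : ℝ) (Λ : Set ℕ) (t : ℝ) : ℝ :=
  ∑' j : ℕ, Λ.indicator (fun j => (2 : ℝ) ^ (-(j : ℝ) * β) * rademacher j t) j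

end

/-- The dyadic interval `[k/2^n, (k+1)/2^n)`. -/
def dyIco (n k : ℕ) : Set ℝ := Set.Ico ((k : ℝ) / 2 ^ n) (((k : ℝ) + 1) / 2 ^ n)

lemma mem_dyIco_iff {n k : ℕ} {t : ℝ} : t ∈ dyIco n k ↔ ⌊(2 : ℝ) ^ n * t⌋ = (k : ℤ) := by
  have h : (0 : ℝ) < 2 ^ n := by positivity
  rw [dyIco, Set.mem_Ico, Int.floor_eq_iff, div_le_iff₀' h, lt_div_iff₀' h]
  simp

lemma volume_dyIco (n k : ℕ) : volume (dyIco n k) = ENNReal.ofReal ((1 / 2) ^ n) := by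
  rw [dyIco, Real.volume_Ico]
  congr 1
  rw [one_div_pow]
  ring

lemma measurableSet_dyIco (n k : ℕ) : MeasurableSet (dyIco n k) := measurableSet_Ico

lemma dyIco_subset_unit {n k : ℕ} (hk : k < 2 ^ n) : dyIco n k ⊆ Set.Ico (0 : ℝ) 1 := by
  apply Set.Ico_subset_Ico
  · positivity
  · rw [div_le_one (by positivity)]
    exact_mod_cast hk

lemma left_mem_dyIco (n k : ℕ) : (k : ℝ) / 2 ^ n ∈ dyIco n k := by
  rw [mem_dyIco_iff, mul_div_cancel₀ _ (by positivity)]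
  simp

lemma dyAtom_dyIco {n k : ℕ} (hk : k < 2 ^ n) : dyAtom (dyIco n k) := ⟨n, k, hk, rfl⟩

lemma disjoint_dyIco {n k l : ℕ} (h : k ≠ l) : Disjoint (dyIco n k) (dyIco n l) := by
  rw [Set.disjoint_left]
  intro t h1 h2
  rw [mem_dyIco_iff] at h1 h2
  exact h (by exact_mod_cast h1.symm.trans h2)

lemma dyIco_injective (n : ℕ) : Function.Injective (dyIco n) := by
  intro k l h
  by_contra hne
  have := disjoint_dyIco (n := n) hne
  rw [← h, disjoint_self] at this
  exact (this ▸ left_mem_dyIco n k : _ ∈ (∅ : Set ℝ))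

lemma floor_two_pow_mul_of_le {m n : ℕ} (h : m ≤ n) (t : ℝ) :
    ⌊(2 : ℝ) ^ m * t⌋ = ⌊(2 : ℝ) ^ n * t⌋ / ((2 ^ (n - m) : ℕ) : ℤ) := by
  rw [← Int.floor_div_natCast]
  congr 1
  obtain ⟨d, rfl⟩ := Nat.exists_eq_add_of_le h
  rw [Nat.add_sub_cancel_left, pow_add]
  push_cast
  field_simp

lemma rademacher_eq_of_mem_dyIco {m n k : ℕ} (h : m ≤ n) {s t : ℝ} (hs : s ∈ dyIco n k)
    (ht : t ∈ dyIco n k) : rademacher m s = rademacher m t := by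
  rw [mem_dyIco_iff] at hs ht
  simp only [rademacher, floor_two_pow_mul_of_le h, hs, ht]

lemma abs_rademacher (n : ℕ) (t : ℝ) : |rademacher n t| = 1 := by
  unfold rademacher
  split_ifs <;> simp

lemma rademacher_add_self (n : ℕ) (t : ℝ) :
    rademacher n (t + (1 / 2) ^ n) = -rademacher n t := by
  have h : (2 : ℝ) ^ n * (t + (1 / 2) ^ n) = 2 ^ n * t + 1 := by
    rw [mul_add, ← mul_pow]
    norm_num
  simp only [rademacher, h, Int.floor_add_one, Int.even_add_one]
  split_ifs <;> simp_all

lemma rademacher_add_of_lt {m n : ℕ} (h : n < m) (t : ℝ) :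
    rademacher m (t + (1 / 2) ^ n) = rademacher m t := by
  obtain ⟨d, rfl⟩ := Nat.exists_eq_add_of_lt h
  have h : (2 : ℝ) ^ (n + d + 1) * (t + (1 / 2) ^ n)
      = 2 ^ (n + d + 1) * t + ((2 ^ (d + 1) : ℕ) : ℝ) := by
    rw [mul_add, add_assoc n, pow_add 2 n (d + 1), mul_right_comm (2 ^ n) (2 ^ (d + 1)) ((1 / 2) ^ n),
      ← mul_pow 2 (1 / 2)]
    norm_num
  have he : Even (((2 ^ (d + 1) : ℕ) : ℤ)) := by
    push_cast
    exact (even_two).pow_of_ne_zero (by omega)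
  simp only [rademacher, h, Int.floor_add_natCast, Int.even_add, he, iff_true]

lemma measurable_rademacher (n : ℕ) : Measurable (rademacher n) := by
  unfold rademacher
  refine Measurable.ite ?_ measurable_const measurable_const
  exact (Int.measurable_floor.comp (measurable_const.mul measurable_id))
    (.of_discrete (s := {z : ℤ | Even z}))

/-- The `j`-th term of the lacunary series `∑_{j ∈ Λ} q^j r_{j+1}`. -/
noncomputable def rademacherTerm (q : ℝ) (Λ : Set ℕ) (t : ℝ) (j : ℕ) : ℝ :=
  Λ.indicator (fun j => q ^ j * rademacher (j + 1) t) j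

/-- The series `∑_{j ∈ Λ} q^j r_{j+1}`. -/
noncomputable def rademacherSeries (q : ℝ) (Λ : Set ℕ) (t : ℝ) : ℝ :=
  ∑' j : ℕ, rademacherTerm q Λ t j

lemma abs_rademacherTerm_le {q : ℝ} (hq : 0 < q) (Λ : Set ℕ) (t : ℝ) (j : ℕ) :
    |rademacherTerm q Λ t j| ≤ q ^ j := by
  unfold rademacherTerm Set.indicator
  split_ifs
  · simp [abs_mul, abs_rademacher, abs_of_pos hq]
  · simp [hq.le]

lemma summable_rademacherTerm {q : ℝ} (hq : 0 < q) (hq1 : q < 1) (Λ : Set ℕ) (t : ℝ) :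
    Summable (rademacherTerm q Λ t) :=
  .of_norm_bounded (summable_geometric_of_lt_one hq.le hq1) (abs_rademacherTerm_le hq Λ t)

lemma abs_rademacherSeries_le {q : ℝ} (hq : 0 < q) (hq1 : q < 1) (Λ : Set ℕ) (t : ℝ) :
    |rademacherSeries q Λ t| ≤ (1 - q)⁻¹ := by
  rw [← Real.norm_eq_abs, rademacherSeries]
  exact tsum_of_norm_bounded (hasSum_geometric_of_lt_one hq.le hq1) (abs_rademacherTerm_le hq Λ t)

lemma measurable_rademacherSeries (q : ℝ) (Λ : Set ℕ) : Measurable (rademacherSeries q Λ) := by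
  refine Measurable.tsum fun j => ?_
  unfold rademacherTerm Set.indicator
  split_ifs
  · exact measurable_const.mul (measurable_rademacher _)
  · exact measurable_const

lemma abs_rademacherSeries_sub_le {q : ℝ} (hq : 0 < q) (hq1 : q < 1) (Λ : Set ℕ) {n k : ℕ}
    {s t : ℝ} (hs : s ∈ dyIco n k) (ht : t ∈ dyIco n k) :
    |rademacherSeries q Λ s - rademacherSeries q Λ t| ≤ 2 * (1 - q)⁻¹ * q ^ n := by
  have hS := summable_rademacherTerm hq hq1 Λ
  rw [rademacherSeries, rademacherSeries, ← (hS s).tsum_sub (hS t),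
    ← ((hS s).sub (hS t)).sum_add_tsum_nat_add n, Finset.sum_eq_zero, zero_add]
  · rw [← Real.norm_eq_abs]
    refine tsum_of_norm_bounded (g := fun j => 2 * q ^ n * q ^ j) ?_ fun j => ?_
    · rw [mul_right_comm]
      exact (hasSum_geometric_of_lt_one hq.le hq1).mul_left (2 * q ^ n)
    · have h1 := abs_rademacherTerm_le hq Λ s (j + n)
      have h2 := abs_rademacherTerm_le hq Λ t (j + n)
      have h3 := norm_sub_le (rademacherTerm q Λ s (j + n)) (rademacherTerm q Λ t (j + n))
      rw [Real.norm_eq_abs (rademacherTerm q Λ s _), Real.norm_eq_abs (rademacherTerm q Λ t _)] at h3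
      rw [pow_add] at h1 h2
      linarith
  · intro j hj
    rw [Finset.mem_range] at hj
    simp only [rademacherTerm, Set.indicator, rademacher_eq_of_mem_dyIco hj hs ht, sub_self]

lemma rademacherSeries_add_sub {q : ℝ} (hq : 0 < q) (hq1 : q < 1) (Λ : Set ℕ) {j k : ℕ}
    {t : ℝ} (ht : t ∈ dyIco j k) (ht' : t + (1 / 2) ^ (j + 1) ∈ dyIco j k) :
    rademacherSeries q Λ (t + (1 / 2) ^ (j + 1)) - rademacherSeries q Λ t
      = -2 * rademacherTerm q Λ t j := by
  have hS := summable_rademacherTerm hq hq1 Λ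
  rw [rademacherSeries, rademacherSeries, ← (hS _).tsum_sub (hS t), tsum_eq_single j]
  · simp only [rademacherTerm, Set.indicator, rademacher_add_self]
    split_ifs <;> ring
  · intro i hi
    have : rademacher (i + 1) (t + (1 / 2) ^ (j + 1)) = rademacher (i + 1) t := by
      rcases lt_or_gt_of_ne hi with h | h
      · exact rademacher_eq_of_mem_dyIco h ht' ht
      · exact rademacher_add_of_lt (by omega) t
    simp only [rademacherTerm, Set.indicator, this, sub_self]

lemma dyAtomOrRing.exists_dyIco {R : Set ℝ} (hR : dyAtomOrRing R) :
    ∃ n k : ℕ, k < 2 ^ n ∧ R ⊆ dyIco n k ∧ MeasurableSet R ∧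
      ENNReal.ofReal ((1 / 2) ^ n) ≤ 2 * volume R := by
  rcases hR with ⟨n, k, hk, rfl⟩ | ⟨_, _, ⟨n, k, hk, rfl⟩, ⟨m, l, hl, rfl⟩, hsub, rfl, hne⟩
  · refine ⟨n, k, hk, subset_rfl, measurableSet_dyIco n k, ?_⟩
    rw [← volume_dyIco n k, two_mul]
    exact le_self_add
  · change dyIco m l ⊆ dyIco n k at hsub
    change (dyIco n k \ dyIco m l).Nonempty at hne
    refine ⟨n, k, hk, Set.sdiff_subset, (measurableSet_dyIco n k).diff (measurableSet_dyIco m l), ?_⟩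
    have hnm : n < m := by
      have hle : volume (dyIco m l) ≤ volume (dyIco n k) := measure_mono hsub
      rw [volume_dyIco, volume_dyIco, ENNReal.ofReal_le_ofReal_iff (by positivity),
        pow_le_pow_iff_right_of_lt_one₀ (by norm_num) (by norm_num)] at hle
      refine hle.lt_of_ne ?_
      rintro rfl
      by_cases h : k = l
      · simp [h] at hne
      · exact Set.disjoint_left.1 (disjoint_dyIco h) (hsub (left_mem_dyIco n l)) (left_mem_dyIco n l)
    have h1 : volume (dyIco n k) - volume (dyIco m l) ≤ volume (dyIco n k \ dyIco m l) :=
      le_measure_sdiff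
    rw [volume_dyIco, volume_dyIco, ← ENNReal.ofReal_sub _ (by positivity)] at h1
    refine le_trans ?_ (mul_le_mul_right h1 2)
    rw [← ENNReal.ofReal_ofNat, ← ENNReal.ofReal_mul (by norm_num)]
    apply ENNReal.ofReal_le_ofReal
    have h2 : ((1 : ℝ) / 2) ^ m ≤ (1 / 2) ^ (n + 1) :=
      pow_le_pow_of_le_one (by norm_num) (by norm_num) hnm
    rw [pow_succ] at h2
    linarith

lemma EpD_rademacherSeries_le {p β q : ℝ} (hp : 0 < p) (hβ : 0 < β) (hqβ : q = (1 / 2) ^ β)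
    (Λ : Set ℕ) {n k : ℕ} {R : Set ℝ} (hR : R ⊆ dyIco n k) :
    EpD p (rademacherSeries q Λ) R
      ≤ ENNReal.ofReal (2 * (1 - q)⁻¹ * ((1 / 2) ^ n) ^ (β + p⁻¹)) := by
  have hq : 0 < q := by rw [hqβ]; positivity
  have hq1 : q < 1 := by rw [hqβ]; exact Real.rpow_lt_one (by norm_num) (by norm_num) hβ
  refine (iInf_le _ (rademacherSeries q Λ ((k : ℝ) / 2 ^ n))).trans ?_
  refine (eLpNorm_mono_measure _ (Measure.restrict_mono hR le_rfl)).trans ?_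
  refine (eLpNorm_le_of_ae_bound (C := 2 * (1 - q)⁻¹ * q ^ n) ?_).trans ?_
  · filter_upwards [ae_restrict_mem (measurableSet_dyIco n k)] with t ht
    exact abs_rademacherSeries_sub_le hq hq1 Λ ht (left_mem_dyIco n k)
  · rw [Measure.restrict_apply_univ, volume_dyIco, ENNReal.toReal_ofReal hp.le,
      ENNReal.ofReal_rpow_of_nonneg (by positivity) (by positivity),
      ← ENNReal.ofReal_mul (by positivity)]
    apply le_of_eq
    congr 1
    rw [Real.rpow_add (by positivity), hqβ, Real.rpow_pow_comm (by norm_num)]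
    ring

lemma varD_rademacherSeries_ne_top {σ p q : ℝ} (hσ : 0 < σ) (hσp : σ < p)
    (hq : q = (1 / 2) ^ (σ⁻¹ - p⁻¹)) (Λ : Set ℕ) : varD σ p (rademacherSeries q Λ) ≠ ∞ := by
  have hp : 0 < p := hσ.trans hσp
  have hβ : 0 < σ⁻¹ - p⁻¹ := sub_pos.2 (inv_strictAnti₀ hσ hσp)
  have hq1 : q < 1 := by rw [hq]; exact Real.rpow_lt_one (by norm_num) (by norm_num) hβ
  set C : ℝ := 2 * (1 - q)⁻¹ with hC
  have hC0 : 0 ≤ C := by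
    have : 0 < 1 - q := by linarith
    positivity
  have key : ∀ R, dyAtomOrRing R → EpD p (rademacherSeries q Λ) R ^ σ
      ≤ ENNReal.ofReal (C ^ σ) * 2 * volume R := by
    intro R hR
    obtain ⟨n, k, -, hsub, -, hvol⟩ := hR.exists_dyIco
    have h := EpD_rademacherSeries_le hp hβ hq Λ hsub
    rw [sub_add_cancel] at h
    refine (ENNReal.rpow_le_rpow h hσ.le).trans ?_
    rw [ENNReal.ofReal_rpow_of_nonneg (by positivity) hσ.le, Real.mul_rpow hC0 (by positivity),
      Real.rpow_inv_rpow (by positivity) hσ.ne', ENNReal.ofReal_mul (by positivity), mul_assoc]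
    gcongr
  refine ne_top_of_le_ne_top (b := (ENNReal.ofReal (C ^ σ) * 2) ^ (1 / σ)) ?_ ?_
  · exact ENNReal.rpow_ne_top_of_nonneg (by positivity)
      (ENNReal.mul_ne_top ENNReal.ofReal_ne_top (by norm_num))
  · refine iSup_le fun P => iSup_le fun hP => iSup_le fun hd => ?_
    refine ENNReal.rpow_le_rpow ?_ (by positivity)
    refine (Finset.sum_le_sum fun R hR => key R (hP R hR)).trans ?_
    rw [← Finset.mul_sum]
    refine mul_le_of_le_one_right' ?_
    have hmeas : ∀ R ∈ P, MeasurableSet (id R) := fun R hR =>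
      (hP R hR).exists_dyIco.choose_spec.choose_spec.2.2.1
    refine (measure_biUnion_finset (f := id) hd hmeas).symm.trans_le ?_
    refine (measure_mono (t := Set.Ico (0 : ℝ) 1) ?_).trans (by simp)
    refine Set.iUnion₂_subset fun R hR => ?_
    obtain ⟨n, k, hk, hsub, -⟩ := (hP R hR).exists_dyIco
    exact hsub.trans (dyIco_subset_unit hk)

/-- Weak-type control of `u - c` on a dyadic interval by a small value of `E_p(u, ·)`. -/
lemma exists_volume_le_of_EpD_lt {σ p η : ℝ} (hp : 0 < p) (hη : 0 ≤ η)
    {u : ℝ → ℝ} (hu : AEMeasurable u (volume.restrict (Set.Ico (0 : ℝ) 1))) {n k : ℕ}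
    (hk : k < 2 ^ n)
    (h : EpD p u (dyIco n k) < ENNReal.ofReal (η * ((1 / 2) ^ n) ^ σ⁻¹)) :
    ∃ c : ℝ, volume ({t | ((1 / 2) ^ n) ^ (σ⁻¹ - p⁻¹) / 2 ≤ |u t - c|} ∩ dyIco n k)
      ≤ ENNReal.ofReal ((2 * η) ^ p * (1 / 2) ^ n) := by
  obtain ⟨c, hc⟩ := iInf_lt_iff.1 h
  refine ⟨c, ?_⟩
  have hW : (0 : ℝ) < (1 / 2) ^ n := by positivity
  set W : ℝ := (1 / 2) ^ n
  set a : ℝ := W ^ (σ⁻¹ - p⁻¹) / 2 with ha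
  have ha0 : 0 < a := by positivity
  have hm : AEStronglyMeasurable (fun t => u t - c) (volume.restrict (dyIco n k)) :=
    ((hu.mono_measure (Measure.restrict_mono (dyIco_subset_unit hk) le_rfl)).sub_const
      c).aestronglyMeasurable
  have h1 := mul_meas_ge_le_pow_eLpNorm' (volume.restrict (dyIco n k))
    (ENNReal.ofReal_pos.2 hp).ne' ENNReal.ofReal_ne_top hm (ENNReal.ofReal a)
  rw [ENNReal.toReal_ofReal hp.le, Measure.restrict_apply' (measurableSet_dyIco n k)] at h1
  have h2 := h1.trans (ENNReal.rpow_le_rpow hc.le hp.le)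
  rw [ENNReal.ofReal_rpow_of_nonneg ha0.le hp.le,
    ENNReal.ofReal_rpow_of_nonneg (by positivity) hp.le] at h2
  have hset : {t | ENNReal.ofReal a ≤ ‖u t - c‖ₑ} = {t | a ≤ |u t - c|} := by
    ext t
    simp only [Set.mem_ofPred_eq, Real.enorm_eq_ofReal_abs,
      ENNReal.ofReal_le_ofReal_iff (abs_nonneg _)]
  rw [hset] at h2
  have hid : (η * W ^ σ⁻¹) ^ p = a ^ p * ((2 * η) ^ p * W) := by
    have h3 : a * (2 * η) * W ^ p⁻¹ = η * W ^ σ⁻¹ := by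
      rw [ha, Real.rpow_sub hW]
      field_simp
    rw [← h3, Real.mul_rpow (by positivity) (by positivity),
      Real.mul_rpow (by positivity) (by positivity), Real.rpow_inv_rpow hW.le hp.ne', mul_assoc]
  rw [hid, ENNReal.ofReal_mul (by positivity)] at h2
  exact (ENNReal.mul_le_mul_iff_right (ENNReal.ofReal_pos.2 (by positivity)).ne'
    ENNReal.ofReal_ne_top).1 h2

lemma exists_EpD_lt_of_varD_lt {σ p η : ℝ} (hσ : 0 < σ) (hη : 0 < η) {u v : ℝ → ℝ}
    (hu : varD σ p u < ENNReal.ofReal (η * (1 / 3) ^ σ⁻¹))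
    (hv : varD σ p v < ENNReal.ofReal (η * (1 / 3) ^ σ⁻¹)) (n : ℕ) :
    ∃ k < 2 ^ n, EpD p u (dyIco n k) < ENNReal.ofReal (η * ((1 / 2) ^ n) ^ σ⁻¹) ∧
      EpD p v (dyIco n k) < ENNReal.ofReal (η * ((1 / 2) ^ n) ^ σ⁻¹) := by
  have hsum : ∀ w : ℝ → ℝ, varD σ p w < ENNReal.ofReal (η * (1 / 3) ^ σ⁻¹) →
      ∑ k ∈ Finset.range (2 ^ n), EpD p w (dyIco n k) ^ σ ≤ ENNReal.ofReal (η ^ σ * (1 / 3)) := by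
    intro w hw
    have h1 : (∑ k ∈ Finset.range (2 ^ n), EpD p w (dyIco n k) ^ σ) ^ (1 / σ) ≤ varD σ p w := by
      rw [← Finset.sum_image (g := dyIco n) (f := fun R => EpD p w R ^ σ)
        ((dyIco_injective n).injOn)]
      refine le_iSup_of_le ((Finset.range (2 ^ n)).image (dyIco n))
        (le_iSup_of_le ?_ (le_iSup_of_le ?_ le_rfl))
      · intro R hR
        obtain ⟨k, hk, rfl⟩ := Finset.mem_image.1 hR
        exact Or.inl (dyAtom_dyIco (Finset.mem_range.1 hk))
      · intro R hR R' hR' hne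
        obtain ⟨k, -, rfl⟩ := Finset.mem_image.1 hR
        obtain ⟨l, -, rfl⟩ := Finset.mem_image.1 hR'
        exact disjoint_dyIco fun h => hne (h ▸ rfl)
    have h2 := ENNReal.rpow_le_rpow (h1.trans hw.le) hσ.le
    rwa [← ENNReal.rpow_mul, one_div_mul_cancel hσ.ne', ENNReal.rpow_one,
      ENNReal.ofReal_rpow_of_nonneg (by positivity) hσ.le,
      Real.mul_rpow hη.le (by positivity), Real.rpow_inv_rpow (by norm_num) hσ.ne'] at h2
  by_contra! hcon
  have hlow : ∀ k ∈ Finset.range (2 ^ n), ENNReal.ofReal (η ^ σ * (1 / 2) ^ n)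
      ≤ EpD p u (dyIco n k) ^ σ + EpD p v (dyIco n k) ^ σ := by
    intro k hk
    have hpow : ENNReal.ofReal (η ^ σ * (1 / 2) ^ n)
        = ENNReal.ofReal (η * ((1 / 2) ^ n) ^ σ⁻¹) ^ σ := by
      rw [ENNReal.ofReal_rpow_of_nonneg (by positivity) hσ.le,
        Real.mul_rpow hη.le (by positivity), Real.rpow_inv_rpow (by positivity) hσ.ne']
    rw [hpow]
    by_cases h : EpD p u (dyIco n k) < ENNReal.ofReal (η * ((1 / 2) ^ n) ^ σ⁻¹)
    · exact (ENNReal.rpow_le_rpow (hcon k (Finset.mem_range.1 hk) h) hσ.le).trans le_add_self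
    · exact (ENNReal.rpow_le_rpow (not_lt.1 h) hσ.le).trans le_self_add
  have h1 := Finset.sum_le_sum hlow
  rw [Finset.sum_add_distrib, Finset.sum_const, Finset.card_range, nsmul_eq_mul] at h1
  have h2 := h1.trans (add_le_add (hsum u hu) (hsum v hv))
  have h3 : ((2 ^ n : ℕ) : ℝ≥0∞) = ENNReal.ofReal (2 ^ n) := by
    rw [← ENNReal.ofReal_natCast]
    push_cast
    rfl
  rw [h3, ← ENNReal.ofReal_mul (by positivity), ← ENNReal.ofReal_add (by positivity)
    (by positivity), ENNReal.ofReal_le_ofReal_iff (by positivity), mul_left_comm, ← mul_pow] at h2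
  norm_num at h2
  have : 0 < η ^ σ := by positivity
  linarith

lemma volume_dyIco_succ_le_of_jump {n k : ℕ} {a c c' : ℝ} {u v : ℝ → ℝ}
    (hjump : ∀ t ∈ dyIco n k, t + (1 / 2) ^ (n + 1) ∈ dyIco n k →
      |(u (t + (1 / 2) ^ (n + 1)) - v (t + (1 / 2) ^ (n + 1))) - (u t - v t)| = 2 * a) :
    volume (dyIco (n + 1) (2 * k)) ≤
      2 * (volume ({t | a / 2 ≤ |u t - c|} ∩ dyIco n k)
        + volume ({t | a / 2 ≤ |v t - c'|} ∩ dyIco n k)) := by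
  set U := {t | a / 2 ≤ |u t - c|} ∩ dyIco n k
  set V := {t | a / 2 ≤ |v t - c'|} ∩ dyIco n k
  set h : ℝ := (1 / 2) ^ (n + 1) with hh
  have hcover : dyIco (n + 1) (2 * k) ⊆ (U ∪ V) ∪ (fun t => t + h) ⁻¹' (U ∪ V) := by
    intro t ht
    have hmem : t ∈ dyIco n k ∧ t + h ∈ dyIco n k := by
      have h2 : (2 : ℝ) ^ (n + 1) * (t + h) = 2 ^ (n + 1) * t + 1 := by
        rw [hh, mul_add, ← mul_pow]
        norm_num
      rw [mem_dyIco_iff] at ht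
      rw [mem_dyIco_iff, mem_dyIco_iff, floor_two_pow_mul_of_le n.le_succ,
        floor_two_pow_mul_of_le n.le_succ, Nat.succ_eq_add_one, h2, Int.floor_add_one, ht,
        Nat.add_sub_cancel_left]
      push_cast
      omega
    have hj := hjump t hmem.1 hmem.2
    by_contra hcon
    simp only [U, V, Set.mem_union, Set.mem_preimage, Set.mem_inter_iff, Set.mem_ofPred_eq, hmem.1,
      hmem.2, and_true, not_or, not_le, abs_lt] at hcon
    obtain ⟨⟨⟨a1, a2⟩, a3, a4⟩, ⟨a5, a6⟩, a7, a8⟩ := hcon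
    rcases abs_cases ((u (t + h) - v (t + h)) - (u t - v t)) with ⟨h1, -⟩ | ⟨h1, -⟩ <;> linarith
  calc volume (dyIco (n + 1) (2 * k))
      ≤ volume (U ∪ V) + volume ((fun t => t + h) ⁻¹' (U ∪ V)) :=
        (measure_mono hcover).trans (measure_union_le _ _)
    _ = 2 * volume (U ∪ V) := by rw [measure_preimage_add_right, two_mul]
    _ ≤ _ := mul_le_mul_right (measure_union_le _ _) _

/-- Two distinct index sets give series with no common approximant in the ring variation. -/
lemma eq_of_varD_sub_lt {σ p q η : ℝ} (hσ : 0 < σ) (hσp : σ < p)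
    (hq : q = (1 / 2) ^ (σ⁻¹ - p⁻¹)) (hη : 0 < η) (hηp : (2 * η) ^ p < 1 / 8)
    {g : ℝ → ℝ} (hg : AEMeasurable g (volume.restrict (Set.Ico (0 : ℝ) 1))) {Λ Λ' : Set ℕ}
    (h : varD σ p (rademacherSeries q Λ - g) < ENNReal.ofReal (η * (1 / 3) ^ σ⁻¹))
    (h' : varD σ p (rademacherSeries q Λ' - g) < ENNReal.ofReal (η * (1 / 3) ^ σ⁻¹)) :
    Λ = Λ' := by
  have hp : 0 < p := hσ.trans hσp
  have hβ : 0 < σ⁻¹ - p⁻¹ := sub_pos.2 (inv_strictAnti₀ hσ hσp)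
  have hq0 : 0 < q := by rw [hq]; positivity
  have hq1 : q < 1 := by rw [hq]; exact Real.rpow_lt_one (by norm_num) (by norm_num) hβ
  ext j
  by_contra hj
  obtain ⟨k, hk, hu, hv⟩ := exists_EpD_lt_of_varD_lt hσ hη h h' j
  obtain ⟨c, hc⟩ := exists_volume_le_of_EpD_lt hp hη.le
    ((measurable_rademacherSeries q Λ).aemeasurable.sub hg) hk hu
  obtain ⟨c', hc'⟩ := exists_volume_le_of_EpD_lt hp hη.le
    ((measurable_rademacherSeries q Λ').aemeasurable.sub hg) hk hv
  have hvol := volume_dyIco_succ_le_of_jump (n := j) (k := k) (c := c) (c' := c')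
    (a := ((1 / 2) ^ j) ^ (σ⁻¹ - p⁻¹)) (u := rademacherSeries q Λ - g)
    (v := rademacherSeries q Λ' - g) (fun t ht ht' => by
      have e1 := rademacherSeries_add_sub hq0 hq1 Λ ht ht'
      have e2 := rademacherSeries_add_sub hq0 hq1 Λ' ht ht'
      have e3 : ((rademacherSeries q Λ - g) (t + (1 / 2) ^ (j + 1))
          - (rademacherSeries q Λ' - g) (t + (1 / 2) ^ (j + 1)))
          - ((rademacherSeries q Λ - g) t - (rademacherSeries q Λ' - g) t)
          = -2 * (rademacherTerm q Λ t j - rademacherTerm q Λ' t j) := by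
        simp only [Pi.sub_apply]
        linarith
      rw [e3, ← Real.rpow_pow_comm (by norm_num), ← hq, abs_mul]
      have e4 : |rademacherTerm q Λ t j - rademacherTerm q Λ' t j| = q ^ j := by
        by_cases hm : j ∈ Λ <;> by_cases hm' : j ∈ Λ' <;>
          simp_all [rademacherTerm, abs_mul, abs_rademacher, abs_of_pos]
      rw [e4]
      norm_num)
  have hle := hvol.trans (mul_le_mul_right (add_le_add hc hc') 2)
  rw [volume_dyIco, ← ENNReal.ofReal_add (by positivity) (by positivity),
    ← ENNReal.ofReal_ofNat, ← ENNReal.ofReal_mul (by norm_num),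
    ENNReal.ofReal_le_ofReal_iff (by positivity), pow_succ] at hle
  have hW : (0 : ℝ) < (1 / 2) ^ j := by positivity
  nlinarith

/-- For every `0 < σ < p < ∞`, the dyadic variation space
`V_{σ,p}(span{1_{[0,1]}})` on `[0,1]`, with the distance induced by `‖f‖_p + |f|_{V_{σ,p}}`,
is not separable: there is no countable subset of `V_{σ,p}` approximating every element. -/
theorem statement12 (σ p : ℝ) (hσ : 0 < σ) (hσp : σ < p) :
    ¬ ∃ D : Set (ℝ → ℝ), D.Countable ∧
      (∀ g ∈ D, AEMeasurable g (volume.restrict (Set.Ico (0 : ℝ) 1)) ∧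
        eLpNorm g (ENNReal.ofReal p) (volume.restrict (Set.Ico (0 : ℝ) 1)) ≠ ∞ ∧
        varD σ p g ≠ ∞) ∧
      ∀ f : ℝ → ℝ,
        AEMeasurable f (volume.restrict (Set.Ico (0 : ℝ) 1)) →
        eLpNorm f (ENNReal.ofReal p) (volume.restrict (Set.Ico (0 : ℝ) 1)) ≠ ∞ →
        varD σ p f ≠ ∞ →
        ∀ ε : ℝ≥0∞, 0 < ε → ∃ g ∈ D,
          eLpNorm (f - g) (ENNReal.ofReal p) (volume.restrict (Set.Ico (0 : ℝ) 1)) +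
            varD σ p (f - g) < ε := by
  rintro ⟨D, hD, hDm, happ⟩
  have hp : 0 < p := hσ.trans hσp
  obtain ⟨q, hq⟩ : ∃ q : ℝ, q = (1 / 2) ^ (σ⁻¹ - p⁻¹) := ⟨_, rfl⟩
  have hβ : 0 < σ⁻¹ - p⁻¹ := sub_pos.2 (inv_strictAnti₀ hσ hσp)
  have hq0 : 0 < q := by rw [hq]; positivity
  have hq1 : q < 1 := by rw [hq]; exact Real.rpow_lt_one (by norm_num) (by norm_num) hβ
  obtain ⟨η, hη, hηp⟩ : ∃ η : ℝ, 0 < η ∧ (2 * η) ^ p < 1 / 8 := by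
    refine ⟨(1 / 16) ^ p⁻¹ / 2, by positivity, ?_⟩
    rw [mul_div_cancel₀ _ two_ne_zero, Real.rpow_inv_rpow (by norm_num) hp.ne']
    norm_num
  have hex : ∀ Λ : Set ℕ, ∃ g ∈ D,
      varD σ p (rademacherSeries q Λ - g) < ENNReal.ofReal (η * (1 / 3) ^ σ⁻¹) := by
    intro Λ
    have hm := measurable_rademacherSeries q Λ
    obtain ⟨g, hg, hlt⟩ := happ (rademacherSeries q Λ) hm.aemeasurable
      (MemLp.of_bound hm.aestronglyMeasurable (1 - q)⁻¹
        (.of_forall (abs_rademacherSeries_le hq0 hq1 Λ))).2.ne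
      (varD_rademacherSeries_ne_top hσ hσp hq Λ) (ENNReal.ofReal (η * (1 / 3) ^ σ⁻¹))
      (ENNReal.ofReal_pos.2 (by positivity))
    exact ⟨g, hg, le_add_self.trans_lt hlt⟩
  choose G hGD hG using hex
  have hinj : Function.Injective fun Λ : Set ℕ => (⟨G Λ, hGD Λ⟩ : D) := by
    intro Λ Λ' he
    have he' : G Λ = G Λ' := congrArg Subtype.val he
    exact eq_of_varD_sub_lt hσ hσp hq hη hηp (hDm _ (hGD Λ)).1 (hG Λ) (he' ▸ hG Λ')
  have : Countable D := hD.to_subtype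
  have hcount : Countable (Set ℕ) := hinj.countable
  obtain ⟨f, hf⟩ := exists_surjective_nat (Set ℕ)
  exact Function.cantor_surjective f hf
end
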